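/- arXiv:0901.1473 — 2 statements merged into one kernel-verified Lean document; each statement's English description precedes it below -/
import Mathlib

section
/- Let y ∈ ℝ^n be any fixed vector and let x ∈ ℝ^n have i.i.d. Gaussian entries x_i ∼ 𝒩(0, σ_x²) with σ_x² > 0. Then for every t ∈ [0,1), the probability that the empirical correlation factor satisfies |ρ̂(x,y)| ≥ t is at most 2·exp(−(n−1)·R₂(t)), where R₂(t) = (1/2)·log(1/(1 − t²)); equivalently, the probability is at most 2·(1 − t²)^{(n−1)/2}. -/
open MeasureTheory ProbabilityTheory Finset
open scoped NNReal

/-- Empirical correlation factor `ρ̂(x,y) = ⟨x,y⟩ / (‖x‖·‖y‖)`, with the convention that it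
is `0` when `x = 0` or `y = 0` (division by zero). -/
noncomputable def empCorr {n : ℕ} (x y : Fin n → ℝ) : ℝ :=
  (∑ i, x i * y i) / (Real.sqrt (∑ i, (x i) ^ 2) * Real.sqrt (∑ i, (y i) ^ 2))

open scoped RealInnerProductSpace

/-- Two-sided Gaussian tail bound. -/
lemma gaussianReal_le_sq_le {q : ℝ} (hq : 0 ≤ q) :
    gaussianReal 0 1 {a : ℝ | q ≤ a ^ 2} ≤ ENNReal.ofReal (2 * Real.exp (-q / 2)) := by
  have key : ∀ X : ℝ → ℝ, (gaussianReal 0 1).map X = gaussianReal 0 1 → Measurable X →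
      gaussianReal 0 1 {a : ℝ | √q ≤ X a} ≤ ENNReal.ofReal (Real.exp (-q / 2)) := by
    intro X hX hm
    have hint : Integrable (fun a => Real.exp (√q * X a)) (gaussianReal 0 1) := by
      have h := integrable_exp_mul_gaussianReal (μ := 0) (v := 1) (√q)
      rw [← hX] at h
      exact h.comp_measurable hm
    have h := measure_ge_le_exp_mul_mgf (μ := gaussianReal 0 1) (X := X) (√q)
      (Real.sqrt_nonneg q) hint
    rw [mgf_gaussianReal hX, ← Real.exp_add] at h
    rw [← ofReal_measureReal]
    refine ENNReal.ofReal_le_ofReal (h.trans_eq ?_)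
    congr 1
    have := Real.mul_self_sqrt hq
    simp only [NNReal.coe_one]
    nlinarith
  have hsub : {a : ℝ | q ≤ a ^ 2} ⊆ {a : ℝ | √q ≤ a} ∪ {a : ℝ | √q ≤ -a} := by
    intro a ha
    have h : √q ≤ |a| := Real.sqrt_le_iff.2 ⟨abs_nonneg a, by simpa using ha⟩
    exact le_abs.1 h
  calc gaussianReal 0 1 {a : ℝ | q ≤ a ^ 2}
      ≤ gaussianReal 0 1 {a : ℝ | √q ≤ a} + gaussianReal 0 1 {a : ℝ | √q ≤ -a} :=
        (measure_mono hsub).trans (measure_union_le _ _)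
    _ ≤ ENNReal.ofReal (Real.exp (-q / 2)) + ENNReal.ofReal (Real.exp (-q / 2)) :=
        add_le_add (key (fun a => a) Measure.map_id' measurable_id)
          (key (fun a => -a) (by simp [gaussianReal_map_neg]) measurable_neg)
    _ = ENNReal.ofReal (2 * Real.exp (-q / 2)) := by
        rw [← ENNReal.ofReal_add (by positivity) (by positivity), two_mul]

lemma integral_exp_neg_mul_sq_gaussianReal {c : ℝ} (hc : 0 ≤ c) :
    ∫ a, Real.exp (-(c * a ^ 2) / 2) ∂gaussianReal 0 1 = (√(1 + c))⁻¹ := by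
  rw [integral_gaussianReal_eq_integral_smul one_ne_zero]
  have h : ∀ a : ℝ, gaussianPDFReal 0 1 a • Real.exp (-(c * a ^ 2) / 2)
      = (√(2 * Real.pi))⁻¹ * Real.exp (-((1 + c) / 2) * a ^ 2) := by
    intro a
    simp only [gaussianPDFReal, NNReal.coe_one, mul_one, sub_zero, smul_eq_mul]
    rw [mul_assoc, ← Real.exp_add]
    congr 2
    ring
  simp_rw [h]
  rw [integral_const_mul, integral_gaussian,
    show Real.pi / ((1 + c) / 2) = (2 * Real.pi) / (1 + c) by field_simp,
    Real.sqrt_div (by positivity)]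
  have : √(2 * Real.pi) ≠ 0 := by positivity
  field_simp

lemma lintegral_exp_neg_mul_sum_sq_pi_gaussianReal (m : ℕ) {c : ℝ} (hc : 0 ≤ c) :
    ∫⁻ w, ENNReal.ofReal (Real.exp (-(c * ∑ i, w i ^ 2) / 2))
      ∂(Measure.pi fun _ : Fin m => gaussianReal 0 1) = ENNReal.ofReal ((√(1 + c))⁻¹ ^ m) := by
  have hprod : ∀ w : Fin m → ℝ, Real.exp (-(c * ∑ i, w i ^ 2) / 2)
      = ∏ i, Real.exp (-(c * w i ^ 2) / 2) := by
    intro w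
    rw [← Real.exp_sum, ← Finset.sum_div, Finset.sum_neg_distrib, Finset.mul_sum]
  rw [← ofReal_integral_eq_lintegral_ofReal]
  · simp_rw [hprod]
    rw [integral_fintype_prod_eq_prod (fun _ a => Real.exp (-(c * a ^ 2) / 2))]
    simp [integral_exp_neg_mul_sq_gaussianReal hc]
  · refine Integrable.of_bound (C := 1) (Measurable.aestronglyMeasurable (by fun_prop)) (.of_forall fun w => ?_)
    rw [Real.norm_of_nonneg (by positivity), Real.exp_le_one_iff]
    have : 0 ≤ c * ∑ i, w i ^ 2 := by positivity
    linarith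
  · exact .of_forall fun w => by positivity

/-- The first coordinate of a standard Gaussian vector rarely dominates the others. -/
lemma pi_gaussianReal_mul_sum_sq_le (m : ℕ) {c : ℝ} (hc : 0 ≤ c) :
    (Measure.pi fun _ : Fin (m + 1) => gaussianReal 0 1)
      {z | c * ∑ i : Fin m, z i.succ ^ 2 ≤ z 0 ^ 2} ≤
      ENNReal.ofReal (2 * (√(1 + c))⁻¹ ^ m) := by
  have hmp := measurePreserving_piFinSuccAbove (fun _ : Fin (m + 1) => gaussianReal 0 1) 0
  set B : Set (ℝ × (Fin m → ℝ)) := {p | c * ∑ i, p.2 i ^ 2 ≤ p.1 ^ 2} with hB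
  have hBm : MeasurableSet B := measurableSet_le (by fun_prop) (by fun_prop)
  have hpre : {z : Fin (m + 1) → ℝ | c * ∑ i : Fin m, z i.succ ^ 2 ≤ z 0 ^ 2} =
      MeasurableEquiv.piFinSuccAbove (fun _ => ℝ) 0 ⁻¹' B := by
    ext z
    simp [hB, MeasurableEquiv.piFinSuccAbove, Fin.insertNthEquiv, Fin.tail]
  rw [hpre, hmp.measure_preimage hBm.nullMeasurableSet, Measure.prod_apply_symm hBm]
  calc _ ≤ ∫⁻ w, ENNReal.ofReal 2 * ENNReal.ofReal (Real.exp (-(c * ∑ i, w i ^ 2) / 2))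
        ∂(Measure.pi fun _ : Fin m => gaussianReal 0 1) := by
        refine lintegral_mono fun w => ?_
        rw [← ENNReal.ofReal_mul (by norm_num)]
        exact gaussianReal_le_sq_le (by positivity)
    _ = _ := by
        rw [lintegral_const_mul _ (by fun_prop),
          lintegral_exp_neg_mul_sum_sq_pi_gaussianReal m hc, ← ENNReal.ofReal_mul (by norm_num)]

/-- Rotation invariance: the direction `u` may be replaced by the first coordinate axis. -/
lemma pi_gaussianReal_mul_sum_sq_le_sq_inner (m : ℕ) {t : ℝ}
    {u : EuclideanSpace ℝ (Fin (m + 1))} (hu : ‖u‖ = 1) :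
    (Measure.pi fun _ : Fin (m + 1) => gaussianReal 0 1)
      {x | t ^ 2 * ∑ i, x i ^ 2 ≤ (∑ i, x i * u i) ^ 2} =
    (Measure.pi fun _ : Fin (m + 1) => gaussianReal 0 1)
      {z | t ^ 2 * ∑ i, z i ^ 2 ≤ z 0 ^ 2} := by
  obtain ⟨b, hb⟩ := Orthonormal.exists_orthonormalBasis_extension_of_card_eq (𝕜 := ℝ)
    (E := EuclideanSpace ℝ (Fin (m + 1))) (ι := Fin (m + 1)) (by simp) (v := fun _ => u)
    (s := {0}) (by
      constructor
      · intro i; simpa using hu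
      · intro i j hij; exact absurd (Subsingleton.elim i j) hij)
  have hb0 : b 0 = u := hb 0 rfl
  set B : Set (EuclideanSpace ℝ (Fin (m + 1))) := {v | t ^ 2 * ‖v‖ ^ 2 ≤ ⟪v, u⟫ ^ 2} with hB
  have hBm : MeasurableSet B := measurableSet_le (by fun_prop) (by fun_prop)
  have h := map_pi_eq_stdGaussian.trans (stdGaussian_eq_map_pi_orthonormalBasis b)
  have h' := congrArg (fun μ => μ B) h
  rw [Measure.map_apply (by fun_prop) hBm, Measure.map_apply (by fun_prop) hBm] at h'
  convert h' using 2
  · ext x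
    simp [hB, EuclideanSpace.real_norm_sq_eq, PiLp.inner_apply, mul_comm]
  · ext z
    have hin : ∀ i, ⟪∑ j, z j • b j, b i⟫ = z i := fun i => by
      simpa using b.orthonormal.inner_left_fintype z i
    have hn : ‖∑ j, z j • b j‖ ^ 2 = ∑ j, z j ^ 2 := by
      rw [← b.sum_sq_inner_left]
      simp_rw [hin]
    simp only [hB, Set.mem_preimage, Set.mem_ofPred_eq, hn, ← hb0, hin]

lemma pi_gaussianReal_apply_eq_smul {n : ℕ} (σ2 : ℝ≥0) {A : Set (Fin n → ℝ)}
    (hA : MeasurableSet A) :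
    Measure.pi (fun _ : Fin n => gaussianReal 0 σ2) A =
      Measure.pi (fun _ : Fin n => gaussianReal 0 1) {x | (fun i => √σ2 * x i) ∈ A} := by
  have h1 : gaussianReal 0 σ2 = (gaussianReal 0 1).map (fun a => √σ2 * a) := by
    rw [gaussianReal_map_const_mul]
    congr 1
    · simp
    · ext; simp
  have h2 : Measure.pi (fun _ : Fin n => gaussianReal 0 σ2) =
      (Measure.pi fun _ : Fin n => gaussianReal 0 1).map (fun x i => √σ2 * x i) := by
    have : ∀ _ : Fin n, SigmaFinite ((gaussianReal 0 1).map (fun a => √σ2 * a)) := fun _ => by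
      rw [← h1]; infer_instance
    rw [Measure.pi_map_pi (fun _ => by fun_prop), ← h1]
  rw [h2, Measure.map_apply (by fun_prop) hA]
  rfl

lemma sq_mul_sum_sq_le_of_le_abs_empCorr {n : ℕ} {x y : Fin n → ℝ} {t : ℝ} (ht : 0 ≤ t)
    (h : t ≤ |empCorr x y|) :
    t ^ 2 * ((∑ i, x i ^ 2) * ∑ i, y i ^ 2) ≤ (∑ i, x i * y i) ^ 2 := by
  have hx : 0 ≤ ∑ i, x i ^ 2 := by positivity
  have hy : 0 ≤ ∑ i, y i ^ 2 := by positivity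
  have h2 : t ^ 2 ≤ (∑ i, x i * y i) ^ 2 / ((∑ i, x i ^ 2) * ∑ i, y i ^ 2) := by
    calc t ^ 2 ≤ |empCorr x y| ^ 2 := pow_le_pow_left₀ ht h 2
      _ = _ := by rw [sq_abs, empCorr, div_pow, mul_pow, Real.sq_sqrt hx, Real.sq_sqrt hy]
  refine (mul_le_mul_of_nonneg_right h2 (mul_nonneg hx hy)).trans ?_
  rcases (mul_nonneg hx hy).eq_or_lt with h0 | h0
  · rw [← h0, mul_zero]
    positivity
  · rw [div_mul_cancel₀ _ h0.ne']

lemma pi_gaussianReal_le_abs_empCorr {n : ℕ} {σ2 : ℝ≥0} (hσ : 0 < σ2) (y : Fin n → ℝ)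
    {t : ℝ} (ht0 : 0 ≤ t) (ht1 : t < 1) :
    Measure.pi (fun _ : Fin n => gaussianReal 0 σ2) {x : Fin n → ℝ | t ≤ |empCorr x y|} ≤
      ENNReal.ofReal (2 * (1 - t ^ 2) ^ (((n : ℝ) - 1) / 2)) := by
  by_cases hy : y = 0
  · have h0 : ∀ x, empCorr x y = 0 := fun x => by simp [empCorr, hy]
    simp only [h0, abs_zero]
    rcases ht0.eq_or_lt with rfl | ht
    · refine prob_le_one.trans ?_
      simp
    · simp [ht.not_ge]
  obtain ⟨m, rfl⟩ : ∃ m, n = m + 1 := by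
    refine Nat.exists_eq_succ_of_ne_zero ?_
    rintro rfl
    exact hy (Subsingleton.elim _ _)
  have ht2 : 0 < 1 - t ^ 2 := by nlinarith
  set v : EuclideanSpace ℝ (Fin (m + 1)) := WithLp.toLp 2 y with hv
  have hv0 : v ≠ 0 := by simpa [hv] using hy
  have hvn : 0 < ‖v‖ := norm_pos_iff.2 hv0
  have hvsq : ‖v‖ ^ 2 = ∑ i, y i ^ 2 := by rw [EuclideanSpace.real_norm_sq_eq]
  set u := ‖v‖⁻¹ • v with hu
  have hun : ‖u‖ = 1 := by rw [hu, norm_smul, norm_inv, norm_norm, inv_mul_cancel₀ hvn.ne']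
  have hA : MeasurableSet {x : Fin (m + 1) → ℝ |
      t ^ 2 * ∑ i, x i ^ 2 ≤ (∑ i, x i * u i) ^ 2} :=
    measurableSet_le (by fun_prop) (by fun_prop)
  have hσ' : 0 < (σ2 : ℝ) := hσ
  calc _ ≤ Measure.pi (fun _ => gaussianReal 0 σ2)
        {x : Fin (m + 1) → ℝ | t ^ 2 * ∑ i, x i ^ 2 ≤ (∑ i, x i * u i) ^ 2} := by
        refine measure_mono fun x hx => ?_
        have h := sq_mul_sum_sq_le_of_le_abs_empCorr ht0 hx
        have hs : ∑ i, x i * u i = ‖v‖⁻¹ * ∑ i, x i * y i := by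
          rw [Finset.mul_sum]
          refine Finset.sum_congr rfl fun i _ => ?_
          simp only [hu, hv, PiLp.smul_apply, smul_eq_mul]
          ring
        rw [Set.mem_ofPred_eq, hs, mul_pow, inv_pow, hvsq, inv_mul_eq_div,
          le_div_iff₀ (by rw [← hvsq]; positivity), mul_assoc]
        exact h
    _ = Measure.pi (fun _ => gaussianReal 0 1)
        {x : Fin (m + 1) → ℝ | t ^ 2 * ∑ i, x i ^ 2 ≤ (∑ i, x i * u i) ^ 2} := by
        rw [pi_gaussianReal_apply_eq_smul σ2 hA]
        congr 1
        ext x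
        simp only [Set.mem_ofPred_eq, mul_pow, mul_assoc, ← Finset.mul_sum,
          Real.sq_sqrt hσ'.le]
        rw [mul_left_comm, mul_le_mul_iff_right₀ hσ']
    _ = Measure.pi (fun _ => gaussianReal 0 1)
        {z : Fin (m + 1) → ℝ | t ^ 2 * ∑ i, z i ^ 2 ≤ z 0 ^ 2} :=
        pi_gaussianReal_mul_sum_sq_le_sq_inner m hun
    _ ≤ Measure.pi (fun _ => gaussianReal 0 1)
        {z : Fin (m + 1) → ℝ | t ^ 2 / (1 - t ^ 2) * ∑ i : Fin m, z i.succ ^ 2 ≤ z 0 ^ 2} := by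
        refine measure_mono fun z hz => ?_
        rw [Set.mem_ofPred_eq, Fin.sum_univ_succ] at hz
        rw [Set.mem_ofPred_eq, div_mul_eq_mul_div, div_le_iff₀ ht2]
        linarith
    _ ≤ ENNReal.ofReal (2 * (√(1 + t ^ 2 / (1 - t ^ 2)))⁻¹ ^ m) :=
        pi_gaussianReal_mul_sum_sq_le m (by positivity)
    _ = _ := by
        have h1 : 1 + t ^ 2 / (1 - t ^ 2) = (1 - t ^ 2)⁻¹ := by field_simp; ring
        rw [h1, Real.sqrt_inv, inv_inv, Real.sqrt_eq_rpow, ← Real.rpow_natCast,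
          ← Real.rpow_mul ht2.le]
        congr 3
        push_cast
        ring

theorem statement3 {n : ℕ} (σ2 : ℝ≥0) (hσ : 0 < σ2) (y : Fin n → ℝ) (t : ℝ)
    (ht0 : 0 ≤ t) (ht1 : t < 1) :
    Measure.pi (fun _ : Fin n => gaussianReal 0 σ2) {x : Fin n → ℝ | t ≤ |empCorr x y|} ≤
        ENNReal.ofReal
          (2 * Real.exp (-((n : ℝ) - 1) * ((1 / 2) * Real.log (1 / (1 - t ^ 2))))) ∧
      Measure.pi (fun _ : Fin n => gaussianReal 0 σ2) {x : Fin n → ℝ | t ≤ |empCorr x y|} ≤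
        ENNReal.ofReal (2 * Real.rpow (1 - t ^ 2) (((n : ℝ) - 1) / 2)) := by
  have h := pi_gaussianReal_le_abs_empCorr hσ y ht0 ht1
  have ht2 : 0 < 1 - t ^ 2 := by nlinarith
  refine ⟨?_, h⟩
  rw [Real.rpow_def_of_pos ht2] at h
  rw [one_div (1 - t ^ 2), Real.log_inv]
  convert h using 4
  ring
end

section
/- Given finite input and output alphabets 𝒳, 𝒴, for every P_e > 0, P_A > 0, δ > 0 and prior Q on 𝒳, there exists n large enough and a randomized adaptive-rate block encoder-decoder pair with feedback over block size n, together with a subset J ⊆ 𝒳^n, such that: (i) the channel input sequence x is distributed Q^n independently of the feedback and of the message; (ii) for every message w and every pair of sequences x ∈ 𝒳^n, y ∈ 𝒴^n, the error probability P_e^(w)(x,y) = Pr( ŵ_1^{⌈nR⌉} ≠ w_1^{⌈nR⌉} | x, y ) is smaller than P_e; (iii) for every input sequence x ∉ J and every output sequence y ∈ 𝒴^n, the decoded rate satisfies R ≥ Î(x;y) − δ; and (iv) Pr(x ∈ J) ≤ P_A. -/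
open Finset MeasureTheory

/-- Joint empirical distribution of two sequences over an index set `A`. -/
noncomputable def empDistOn {n : ℕ} {𝒳 𝒴 : Type*} [DecidableEq 𝒳] [DecidableEq 𝒴]
    (A : Finset (Fin n)) (x : Fin n → 𝒳) (y : Fin n → 𝒴) (a : 𝒳) (b : 𝒴) : ℝ :=
  ((A.filter fun i => x i = a ∧ y i = b).card : ℝ) / (A.card : ℝ)

/-- Mutual information of a joint distribution `p` on a finite product alphabet, in bits. -/
noncomputable def miOf {𝒳 𝒴 : Type*} [Fintype 𝒳] [Fintype 𝒴] (p : 𝒳 → 𝒴 → ℝ) : ℝ :=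
  ∑ a, ∑ b, p a b * Real.logb 2 (p a b / ((∑ b', p a b') * (∑ a', p a' b)))

/-- Empirical mutual information `Î(x;y)` of two sequences, in bits. -/
noncomputable def empMI {n : ℕ} {𝒳 𝒴 : Type*} [Fintype 𝒳] [Fintype 𝒴]
    [DecidableEq 𝒳] [DecidableEq 𝒴] (x : Fin n → 𝒳) (y : Fin n → 𝒴) : ℝ :=
  miOf (empDistOn Finset.univ x y)

/-- Probability of a set of sequences under the i.i.d. product distribution `Q^n`. -/
noncomputable def prodProb {n : ℕ} {𝒳 : Type*} [Fintype 𝒳] (Q : 𝒳 → ℝ)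
    (S : Set (Fin n → 𝒳)) : ℝ :=
  ∑ x : Fin n → 𝒳, S.indicator (fun z => ∏ i, Q (z i)) x


section Decoder

variable {n : ℕ} {𝒳 𝒴 G : Type*} [Fintype 𝒳]

/-- The reverse channel obtained by normalizing each column `N(·,b)` of a table of counts. -/
noncomputable def reverseChannel (N : 𝒳 → 𝒴 → Fin (n + 1)) (a : 𝒳) (b : 𝒴) : ℝ :=
  ((N a b : ℕ) : ℝ) / ∑ a', ((N a' b : ℕ) : ℝ)

lemma reverseChannel_nonneg (N : 𝒳 → 𝒴 → Fin (n + 1)) (a : 𝒳) (b : 𝒴) :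
    0 ≤ reverseChannel N a b := by
  unfold reverseChannel; positivity

lemma sum_reverseChannel_le_one (N : 𝒳 → 𝒴 → Fin (n + 1)) (b : 𝒴) :
    ∑ a, reverseChannel N a b ≤ 1 := by
  unfold reverseChannel
  rw [← Finset.sum_div]
  exact div_self_le_one _

lemma reverseChannel_le_one (N : 𝒳 → 𝒴 → Fin (n + 1)) (a : 𝒳) (b : 𝒴) :
    reverseChannel N a b ≤ 1 :=
  (Finset.single_le_sum (f := fun a => reverseChannel N a b)
    (fun a _ => reverseChannel_nonneg N a b) (Finset.mem_univ a)).trans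
    (sum_reverseChannel_le_one N b)

/-- Likelihood ratio of the reverse channel `V(a|b)` against the prior `Q(a)`. -/
noncomputable def score (Q : 𝒳 → ℝ) (N : 𝒳 → 𝒴 → Fin (n + 1)) (a : 𝒳) (b : 𝒴) : ℝ :=
  reverseChannel N a b / Q a

lemma score_nonneg {Q : 𝒳 → ℝ} (hQ0 : ∀ a, 0 ≤ Q a) (N : 𝒳 → 𝒴 → Fin (n + 1)) (a : 𝒳) (b : 𝒴) :
    0 ≤ score Q N a b :=
  div_nonneg (reverseChannel_nonneg N a b) (hQ0 a)

lemma log_score_le {Q : 𝒳 → ℝ} (N : 𝒳 → 𝒴 → Fin (n + 1)) (a : 𝒳) (b : 𝒴)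
    (hN : 0 < reverseChannel N a b) (ha : 0 < Q a) :
    Real.logb 2 (score Q N a b) ≤ ∑ a', |Real.logb 2 (Q a')| := by
  rw [score, Real.logb_div hN.ne' ha.ne']
  have h1 : Real.logb 2 (reverseChannel N a b) ≤ 0 :=
    Real.logb_nonpos (by norm_num) hN.le (reverseChannel_le_one N a b)
  have h2 := Finset.single_le_sum (f := fun a' => |Real.logb 2 (Q a')|)
    (fun _ _ => abs_nonneg _) (Finset.mem_univ a)
  have h3 := neg_abs_le (Real.logb 2 (Q a))
  linarith

/-- Likelihood ratio accumulated over the times `s ≤ i < e`. -/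
noncomputable def blockScore (Q : 𝒳 → ℝ) (N : 𝒳 → 𝒴 → Fin (n + 1)) (c : Fin n → 𝒳)
    (y : Fin n → 𝒴) (s e : ℕ) : ℝ :=
  ∏ i with s ≤ i.1 ∧ i.1 < e, score Q N (c i) (y i)

lemma blockScore_nonneg {Q : 𝒳 → ℝ} (hQ0 : ∀ a, 0 ≤ Q a) (N : 𝒳 → 𝒴 → Fin (n + 1))
    (c : Fin n → 𝒳) (y : Fin n → 𝒴) (s e : ℕ) : 0 ≤ blockScore Q N c y s e :=
  Finset.prod_nonneg fun _ _ => score_nonneg hQ0 N _ _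

lemma blockScore_congr (Q : 𝒳 → ℝ) (N : 𝒳 → 𝒴 → Fin (n + 1)) {c c' : Fin n → 𝒳}
    {y y' : Fin n → 𝒴} {s e : ℕ} (hc : ∀ i : Fin n, s ≤ i.1 → i.1 < e → c i = c' i)
    (hy : ∀ i : Fin n, s ≤ i.1 → i.1 < e → y i = y' i) :
    blockScore Q N c y s e = blockScore Q N c' y' s e := by
  refine Finset.prod_congr rfl fun i hi => ?_
  simp only [Finset.mem_filter, Finset.mem_univ, true_and] at hi
  rw [hc i hi.1 hi.2, hy i hi.1 hi.2]

/-- Codeword `j` passes the threshold test on the times `s ≤ i < e`. -/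
def Passes (Q : 𝒳 → ℝ) (θ : ℝ) (C : G → Fin n → 𝒳) (y : Fin n → 𝒴) (s e : ℕ) (j : G) : Prop :=
  ∃ N : 𝒳 → 𝒴 → Fin (n + 1), θ ≤ blockScore Q N (C j) y s e

open Classical in
/-- One step of the rateless decoder: if some codeword passes the test `P` on the current block, the
block ends after `k` outputs and such a codeword is decoded. -/
noncomputable def decStep (P : ℕ → G → Prop) (k : ℕ) (t : ℕ × ℕ × (ℕ → G)) : ℕ × ℕ × (ℕ → G) :=
  if h : ∃ j, P t.1 j then (k, t.2.1 + 1, Function.update t.2.2 t.2.1 h.choose) else t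

/-- State of the rateless decoder after `k` outputs: the start of the current block, the number of
completed blocks, and the chunks decoded so far. -/
noncomputable def decState (Q : 𝒳 → ℝ) (θ : ℝ) (g₀ : G) (C : G → Fin n → 𝒳) (y : Fin n → 𝒴) :
    ℕ → ℕ × ℕ × (ℕ → G)
  | 0 => (0, 0, fun _ => g₀)
  | k + 1 => decStep (fun s => Passes Q θ C y s (k + 1)) (k + 1) (decState Q θ g₀ C y k)

variable (Q : 𝒳 → ℝ) (θ : ℝ) (g₀ : G)

lemma decState_succ_pos (C : G → Fin n → 𝒳) (y : Fin n → 𝒴) (k : ℕ)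
    (h : ∃ j, Passes Q θ C y (decState Q θ g₀ C y k).1 (k + 1) j) :
    ∃ j, Passes Q θ C y (decState Q θ g₀ C y k).1 (k + 1) j ∧
      decState Q θ g₀ C y (k + 1) = (k + 1, (decState Q θ g₀ C y k).2.1 + 1,
        Function.update (decState Q θ g₀ C y k).2.2 (decState Q θ g₀ C y k).2.1 j) :=
  ⟨h.choose, h.choose_spec, dif_pos h⟩

lemma decState_succ_neg (C : G → Fin n → 𝒳) (y : Fin n → 𝒴) (k : ℕ)
    (h : ¬ ∃ j, Passes Q θ C y (decState Q θ g₀ C y k).1 (k + 1) j) :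
    decState Q θ g₀ C y (k + 1) = decState Q θ g₀ C y k :=
  dif_neg h

lemma decState_congr {C C' : G → Fin n → 𝒳} {y y' : Fin n → 𝒴} (k : ℕ)
    (hC : ∀ g, ∀ i : Fin n, i.1 < k → C g i = C' g i) (hy : ∀ i : Fin n, i.1 < k → y i = y' i) :
    decState Q θ g₀ C y k = decState Q θ g₀ C' y' k := by
  induction k with
  | zero => rfl
  | succ k ih =>
    have ih := ih (fun g i hi => hC g i (by omega)) (fun i hi => hy i (by omega))
    have hp : ∀ s, Passes Q θ C y s (k + 1) = Passes Q θ C' y' s (k + 1) := by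
      intro s
      funext j
      unfold Passes
      congr 1
      funext N
      rw [blockScore_congr Q N (fun i _ hi => hC j i hi) (fun i _ hi => hy i hi)]
    simp only [decState, ih, hp]

lemma decState_start_le (C : G → Fin n → 𝒳) (y : Fin n → 𝒴) (k : ℕ) :
    (decState Q θ g₀ C y k).1 ≤ k := by
  induction k with
  | zero => simp [decState]
  | succ k ih =>
    by_cases h : ∃ j, Passes Q θ C y (decState Q θ g₀ C y k).1 (k + 1) j
    · obtain ⟨j, -, hj⟩ := decState_succ_pos Q θ g₀ C y k h
      simp [hj]
    · rw [decState_succ_neg Q θ g₀ C y k h]; omega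

lemma decState_count_eq (C : G → Fin n → 𝒳) (y : Fin n → 𝒴) (k i : ℕ)
    (hs : (decState Q θ g₀ C y k).1 ≤ i) (hi : i ≤ k) :
    (decState Q θ g₀ C y i).2.1 = (decState Q θ g₀ C y k).2.1 := by
  induction k with
  | zero => obtain rfl : i = 0 := by omega
            rfl
  | succ k ih =>
    rcases hi.eq_or_lt with rfl | hi
    · rfl
    by_cases h : ∃ j, Passes Q θ C y (decState Q θ g₀ C y k).1 (k + 1) j
    · obtain ⟨j, -, hj⟩ := decState_succ_pos Q θ g₀ C y k h
      simp only [hj] at hs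
      omega
    · rw [decState_succ_neg Q θ g₀ C y k h] at hs ⊢
      exact ih hs (by omega)

/-- The codebook re-indexed at every time so that row `g₀` is the transmitted sequence. -/
noncomputable def relabel [DecidableEq G] (m : ℕ → G) (y : Fin n → 𝒴) (C : G → Fin n → 𝒳) :
    G → Fin n → 𝒳 :=
  fun d k => C (Equiv.swap g₀ (m (decState Q θ g₀ C y k).2.1) d) k

lemma relabel_injective [DecidableEq G] (m : ℕ → G) (y : Fin n → 𝒴) :
    Function.Injective (relabel (𝒳 := 𝒳) Q θ g₀ m y) := by
  intro C C' h
  have key : ∀ k : ℕ, ∀ i : Fin n, i.1 = k → ∀ g, C g i = C' g i := by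
    intro k
    induction k using Nat.strong_induction_on with
    | _ k ih =>
      rintro i rfl g
      have hst := decState_congr Q θ g₀ (C := C) (C' := C') (y := y) (y' := y) i.1
        (fun g i' hi' => ih i'.1 hi' i' rfl g) (fun _ _ => rfl)
      have := congrFun (congrFun h (Equiv.swap g₀ (m (decState Q θ g₀ C y i).2.1) g)) i
      simpa [relabel, ← hst] using this
  funext g i
  exact key i.1 i rfl g

/-- Some codeword other than the transmitted one passes the threshold test on some interval. -/
def Confusable (C : G → Fin n → 𝒳) (y : Fin n → 𝒴) : Prop :=
  ∃ d, d ≠ g₀ ∧ ∃ N : 𝒳 → 𝒴 → Fin (n + 1), ∃ s e : Fin (n + 1), θ ≤ blockScore Q N (C d) y s e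

lemma decoded_eq_of_not_confusable [DecidableEq G] (m : ℕ → G) (y : Fin n → 𝒴)
    (C : G → Fin n → 𝒳) (hC : ¬ Confusable Q θ g₀ (relabel Q θ g₀ m y C) y) (k : ℕ) (hk : k ≤ n)
    (b : ℕ) (hb : b < (decState Q θ g₀ C y k).2.1) : (decState Q θ g₀ C y k).2.2 b = m b := by
  induction k with
  | zero => simp [decState] at hb
  | succ k ih =>
    by_cases h : ∃ j, Passes Q θ C y (decState Q θ g₀ C y k).1 (k + 1) j
    · obtain ⟨j, ⟨N, hN⟩, hj⟩ := decState_succ_pos Q θ g₀ C y k h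
      rw [hj] at hb ⊢
      have hs := decState_start_le Q θ g₀ C y k
      simp only at hb ⊢
      by_cases hbc : b = (decState Q θ g₀ C y k).2.1
      · subst hbc
        simp only [Function.update_self]
        by_contra hne
        refine hC ⟨Equiv.swap g₀ (m (decState Q θ g₀ C y k).2.1) j, fun h0 => hne ?_, N,
          ⟨(decState Q θ g₀ C y k).1, by omega⟩, ⟨k + 1, by omega⟩, ?_⟩
        · have := (Equiv.swap_apply_eq_iff (x := g₀)).1 h0
          simpa using this
        · refine hN.trans_eq (blockScore_congr Q N (fun i hi1 hi2 => ?_) fun _ _ _ => rfl)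
          rw [relabel, decState_count_eq Q θ g₀ C y k i hi1 (by omega), Equiv.swap_apply_self]
      · rw [Function.update_of_ne hbc]
        exact ih (by omega) (by omega)
    · rw [decState_succ_neg Q θ g₀ C y k h] at hb ⊢
      exact ih (by omega) hb

lemma sum_log_score_le [DecidableEq G] (hθ : 1 ≤ θ) (m : ℕ → G) (y : Fin n → 𝒴)
    (C : G → Fin n → 𝒳) (N : 𝒳 → 𝒴 → Fin (n + 1)) (c : ℝ)
    (hpos : ∀ i, 0 < score Q N (relabel Q θ g₀ m y C g₀ i) (y i))
    (hc : ∀ i, Real.logb 2 (score Q N (relabel Q θ g₀ m y C g₀ i) (y i)) ≤ c) :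
    ∑ i, Real.logb 2 (score Q N (relabel Q θ g₀ m y C g₀ i) (y i)) ≤
      (decState Q θ g₀ C y n).2.1 * (Real.logb 2 θ + c) + Real.logb 2 θ := by
  set L : Fin n → ℝ := fun i => Real.logb 2 (score Q N (relabel Q θ g₀ m y C g₀ i) (y i)) with hL
  have hT : 0 ≤ Real.logb 2 θ := Real.logb_nonneg (by norm_num) hθ
  have key : ∀ k ≤ n,
      ∑ i with i.1 < (decState Q θ g₀ C y k).1, L i ≤
        (decState Q θ g₀ C y k).2.1 * (Real.logb 2 θ + c) ∧
      ∑ i with (decState Q θ g₀ C y k).1 ≤ i.1 ∧ i.1 < k, L i ≤ Real.logb 2 θ := by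
    intro k hk
    induction k with
    | zero => simp [decState, hT]
    | succ k ih =>
      obtain ⟨ih1, ih2⟩ := ih (by omega)
      have hs := decState_start_le Q θ g₀ C y k
      by_cases h : ∃ j, Passes Q θ C y (decState Q θ g₀ C y k).1 (k + 1) j
      · obtain ⟨j, -, hj⟩ := decState_succ_pos Q θ g₀ C y k h
        rw [hj]
        refine ⟨?_, ?_⟩
        · have hsplit : ∑ i with i.1 < k + 1, L i =
              ∑ i with i.1 < (decState Q θ g₀ C y k).1, L i +
              ∑ i with (decState Q θ g₀ C y k).1 ≤ i.1 ∧ i.1 < k, L i + L ⟨k, by omega⟩ := by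
            rw [← Finset.sum_union, ← Finset.sum_singleton L ⟨k, by omega⟩, ← Finset.sum_union]
            · congr 1
              ext i
              simp only [Finset.mem_filter, Finset.mem_univ, true_and, Finset.mem_singleton,
                Finset.mem_union, Fin.ext_iff]
              omega
            · simp only [Finset.disjoint_singleton_right, Finset.mem_filter, Finset.mem_univ,
                true_and, Finset.mem_union]
              omega
            · rw [Finset.disjoint_filter]
              intro i _ h1 h2
              omega
          have hck : L ⟨k, by omega⟩ ≤ c := hc _
          simp only [hsplit]
          push_cast
          linarith
        · rw [Finset.filter_false_of_mem (fun i _ => by simp only; omega)]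
          simpa using hT
      · rw [decState_succ_neg Q θ g₀ C y k h]
        refine ⟨ih1, ?_⟩
        have hlt : blockScore Q N (relabel Q θ g₀ m y C g₀) y (decState Q θ g₀ C y k).1 (k + 1) <
            θ := by
          by_contra hle
          refine h ⟨m (decState Q θ g₀ C y k).2.1, N, (not_lt.1 hle).trans_eq
            (blockScore_congr Q N (fun i hi1 hi2 => ?_) fun _ _ _ => rfl)⟩
          rw [relabel, decState_count_eq Q θ g₀ C y k i hi1 (by omega), Equiv.swap_apply_left]
        rw [hL, ← Real.logb_prod _ _ (fun i _ => (hpos i).ne')]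
        exact Real.logb_le_logb_of_le (by norm_num) (Finset.prod_pos fun i _ => hpos i) hlt.le
  obtain ⟨h1, h2⟩ := key n le_rfl
  rw [← Finset.sum_filter_add_sum_filter_not _ (fun i => i.1 < (decState Q θ g₀ C y n).1)]
  refine add_le_add h1 (le_trans (le_of_eq ?_) h2)
  congr 1
  ext i
  simp

end Decoder

section RandomCodebook

variable {n : ℕ} {𝒳 𝒴 G : Type*} [Fintype G]

/-- Probability of a codebook whose entries are i.i.d. with law `Q`. -/
noncomputable def codebookWeight (Q : 𝒳 → ℝ) (C : G → Fin n → 𝒳) : ℝ := ∏ g, ∏ k, Q (C g k)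

lemma codebookWeight_nonneg {Q : 𝒳 → ℝ} (hQ0 : ∀ a, 0 ≤ Q a) (C : G → Fin n → 𝒳) :
    0 ≤ codebookWeight Q C :=
  Finset.prod_nonneg fun _ _ => Finset.prod_nonneg fun _ _ => hQ0 _

variable [Fintype 𝒳]

lemma codebookWeight_relabel [DecidableEq G] (Q : 𝒳 → ℝ) (θ : ℝ) (g₀ : G) (m : ℕ → G)
    (y : Fin n → 𝒴) (C : G → Fin n → 𝒳) :
    codebookWeight Q (relabel Q θ g₀ m y C) = codebookWeight Q C := by
  unfold codebookWeight
  rw [Finset.prod_comm, Finset.prod_comm (f := fun g k => Q (C g k))]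
  refine Finset.prod_congr rfl fun k _ => ?_
  exact Equiv.prod_comp (Equiv.swap g₀ (m (decState Q θ g₀ C y k).2.1)) fun g => Q (C g k)

lemma sum_codebookWeight_relabel [DecidableEq G] [DecidableEq 𝒳] (Q : 𝒳 → ℝ) (θ : ℝ) (g₀ : G)
    (m : ℕ → G) (y : Fin n → 𝒴) (f : (G → Fin n → 𝒳) → ℝ) :
    ∑ C, codebookWeight Q C * f (relabel Q θ g₀ m y C) = ∑ C, codebookWeight Q C * f C := by
  have hb : Function.Bijective (relabel (𝒳 := 𝒳) Q θ g₀ m y) :=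
    Finite.injective_iff_bijective.1 (relabel_injective Q θ g₀ m y)
  rw [← hb.sum_comp (fun C => codebookWeight Q C * f C)]
  simp only [codebookWeight_relabel]

lemma sum_prod_eq_one {ι : Type*} [Fintype ι] [DecidableEq ι] {Q : 𝒳 → ℝ} (hQ1 : ∑ a, Q a = 1) :
    ∑ c : ι → 𝒳, ∏ i, Q (c i) = 1 := by
  have := Finset.prod_univ_sum (fun _ : ι => (Finset.univ : Finset 𝒳)) (fun _ a => Q a)
  rw [Fintype.piFinset_univ] at this
  rw [← this]
  simp [hQ1]

lemma sum_prod_mul_blockScore_le_one {Q : 𝒳 → ℝ} (hQ0 : ∀ a, 0 ≤ Q a) (hQ1 : ∑ a, Q a = 1)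
    (N : 𝒳 → 𝒴 → Fin (n + 1)) (y : Fin n → 𝒴) (s e : ℕ) :
    ∑ c : Fin n → 𝒳, (∏ k, Q (c k)) * blockScore Q N c y s e ≤ 1 := by
  have := Finset.prod_univ_sum (fun _ : Fin n => (Finset.univ : Finset 𝒳))
    (fun k a => Q a * if s ≤ k.1 ∧ k.1 < e then score Q N a (y k) else 1)
  rw [Fintype.piFinset_univ] at this
  simp only [blockScore, Finset.prod_filter, ← Finset.prod_mul_distrib]
  rw [← this]
  refine Finset.prod_le_one (fun k _ => Finset.sum_nonneg fun a _ => ?_) fun k _ => ?_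
  · split_ifs
    · exact mul_nonneg (hQ0 a) (score_nonneg hQ0 N a _)
    · simpa using hQ0 a
  · split_ifs
    · refine le_trans (Finset.sum_le_sum fun a _ => ?_) (sum_reverseChannel_le_one N (y k))
      unfold score
      rcases (hQ0 a).eq_or_lt with h | h
      · simpa [← h] using reverseChannel_nonneg N a _
      · rw [mul_div_cancel₀ _ h.ne']
    · simp [hQ1]

lemma sum_codebookWeight_fixed_row [DecidableEq G] [DecidableEq 𝒳] {Q : 𝒳 → ℝ}
    (hQ1 : ∑ a, Q a = 1) (g₀ : G) (x : Fin n → 𝒳) :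
    ∑ C : G → Fin n → 𝒳, codebookWeight Q C * (if C g₀ = x then 1 else 0) = ∏ i, Q (x i) := by
  have := Finset.prod_univ_sum (fun _ : G => (Finset.univ : Finset (Fin n → 𝒳)))
    (fun g c => (∏ k, Q (c k)) * if g = g₀ then (if c = x then 1 else 0) else 1)
  rw [Fintype.piFinset_univ] at this
  rw [Finset.sum_congr rfl (fun C _ => ?_), ← this]
  · rw [Fintype.prod_eq_single g₀]
    · simp
    · intro g hg
      simpa [hg] using sum_prod_eq_one hQ1
  · rw [Finset.prod_mul_distrib, codebookWeight]
    simp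

lemma sum_codebookWeight_blockScore_le [DecidableEq G] [DecidableEq 𝒳] {Q : 𝒳 → ℝ}
    (hQ0 : ∀ a, 0 ≤ Q a) (hQ1 : ∑ a, Q a = 1) (g₀ d : G) (hd : d ≠ g₀) (x : Fin n → 𝒳)
    (N : 𝒳 → 𝒴 → Fin (n + 1)) (y : Fin n → 𝒴) (s e : ℕ) :
    ∑ C : G → Fin n → 𝒳, codebookWeight Q C *
      ((if C g₀ = x then 1 else 0) * blockScore Q N (C d) y s e) ≤ ∏ i, Q (x i) := by
  have := Finset.prod_univ_sum (fun _ : G => (Finset.univ : Finset (Fin n → 𝒳)))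
    (fun g c => (∏ k, Q (c k)) * if g = g₀ then (if c = x then 1 else 0) else
      if g = d then blockScore Q N c y s e else 1)
  rw [Fintype.piFinset_univ] at this
  rw [Finset.sum_congr rfl (fun C _ => ?_), ← this]
  · rw [Fintype.prod_eq_mul g₀ d hd.symm]
    · simp only [if_true, if_neg hd]
      have h0 : 0 ≤ ∏ i, Q (x i) := Finset.prod_nonneg fun _ _ => hQ0 _
      simpa using mul_le_mul_of_nonneg_left (sum_prod_mul_blockScore_le_one hQ0 hQ1 N y s e) h0
    · rintro g ⟨hg, hg'⟩
      simpa [hg, hg'] using sum_prod_eq_one hQ1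
  · rw [Finset.prod_mul_distrib, codebookWeight]
    congr 1
    rw [Fintype.prod_eq_mul g₀ d hd.symm]
    · simp [hd]
    · rintro g ⟨hg, hg'⟩
      simp [hg, hg']

lemma sum_codebookWeight_confusable_le [Fintype 𝒴] [DecidableEq G] [DecidableEq 𝒳] {Q : 𝒳 → ℝ}
    (hQ0 : ∀ a, 0 ≤ Q a) (hQ1 : ∑ a, Q a = 1) (g₀ : G) {θ : ℝ} (hθ : 0 < θ) (x : Fin n → 𝒳)
    (y : Fin n → 𝒴)
    [DecidablePred fun C : G → Fin n → 𝒳 => C g₀ = x ∧ Confusable Q θ g₀ C y] :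
    ∑ C : G → Fin n → 𝒳, codebookWeight Q C *
        (if C g₀ = x ∧ Confusable Q θ g₀ C y then 1 else 0) ≤
      (Fintype.card G * (n + 1 : ℝ) ^ (Fintype.card 𝒴 * Fintype.card 𝒳 + 2)) * (∏ i, Q (x i)) / θ
      := by
  classical
  let I := {d : G // d ≠ g₀} × (𝒳 → 𝒴 → Fin (n + 1)) × Fin (n + 1) × Fin (n + 1)
  have h0 : 0 ≤ ∏ i, Q (x i) := Finset.prod_nonneg fun _ _ => hQ0 _
  have hterm : ∀ (t : I) (C : G → Fin n → 𝒳),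
      0 ≤ (if C g₀ = x then (1 : ℝ) else 0) * blockScore Q t.2.1 (C t.1) y t.2.2.1 t.2.2.2 / θ :=
    fun t C => div_nonneg (mul_nonneg (by split_ifs <;> norm_num)
      (blockScore_nonneg hQ0 _ _ _ _ _)) hθ.le
  calc _ ≤ ∑ C : G → Fin n → 𝒳, codebookWeight Q C * ∑ t : I,
        (if C g₀ = x then (1 : ℝ) else 0) * blockScore Q t.2.1 (C t.1) y t.2.2.1 t.2.2.2 / θ := by
        refine Finset.sum_le_sum fun C _ =>
          mul_le_mul_of_nonneg_left ?_ (codebookWeight_nonneg hQ0 C)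
        by_cases h : C g₀ = x ∧ Confusable Q θ g₀ C y
        · rw [if_pos h]
          obtain ⟨hx, d, hd, N, s, e, hN⟩ := h
          refine le_trans ?_ (Finset.single_le_sum (fun t _ => hterm t C)
            (Finset.mem_univ (⟨⟨d, hd⟩, N, s, e⟩ : I)))
          simp only [hx, if_true, one_mul]
          rwa [one_le_div hθ]
        · rw [if_neg h]
          exact Finset.sum_nonneg fun t _ => hterm t C
    _ = ∑ t : I, (∑ C : G → Fin n → 𝒳, codebookWeight Q C *
        ((if C g₀ = x then (1 : ℝ) else 0) * blockScore Q t.2.1 (C t.1) y t.2.2.1 t.2.2.2)) / θ := by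
        simp only [Finset.mul_sum]
        rw [Finset.sum_comm]
        refine Finset.sum_congr rfl fun t _ => ?_
        rw [Finset.sum_div]
        exact Finset.sum_congr rfl fun C _ => by ring
    _ ≤ ∑ _t : I, (∏ i, Q (x i)) / θ :=
        Finset.sum_le_sum fun t _ => div_le_div_of_nonneg_right
          (sum_codebookWeight_blockScore_le hQ0 hQ1 g₀ t.1 t.1.2 x t.2.1 y _ _) hθ.le
    _ ≤ _ := by
        rw [Finset.sum_const, nsmul_eq_mul, ← mul_div_assoc]
        have hcard : (Fintype.card {d : G // d ≠ g₀} : ℝ) ≤ Fintype.card G := by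
          exact_mod_cast Fintype.card_subtype_le _
        gcongr
        simp only [Finset.card_univ, I, Fintype.card_prod, Fintype.card_fun, Fintype.card_fin]
        push_cast
        rw [pow_add, pow_mul]
        calc _ = (Fintype.card {d : G // d ≠ g₀} : ℝ) *
              (((n + 1 : ℝ) ^ Fintype.card 𝒴) ^ Fintype.card 𝒳 * (n + 1) ^ 2) := by ring
          _ ≤ _ := by gcongr

end RandomCodebook

section EmpiricalCounts

variable {n : ℕ} {𝒳 𝒴 : Type*} [DecidableEq 𝒳] [DecidableEq 𝒴]

/-- Table of joint occurrence counts of two sequences. -/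
def jointCount (x : Fin n → 𝒳) (y : Fin n → 𝒴) (a : 𝒳) (b : 𝒴) : Fin (n + 1) :=
  ⟨#{i | x i = a ∧ y i = b}, Nat.lt_succ_of_le
    ((Finset.card_filter_le (univ : Finset (Fin n)) _).trans_eq (by simp))⟩

lemma jointCount_pos (x : Fin n → 𝒳) (y : Fin n → 𝒴) (i : Fin n) :
    0 < ((jointCount x y (x i) (y i) : ℕ) : ℝ) := by
  have : 0 < #{j | x j = x i ∧ y j = y i} := Finset.card_pos.2 ⟨i, by simp⟩
  exact_mod_cast this

variable [Fintype 𝒳]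

lemma reverseChannel_jointCount_pos (x : Fin n → 𝒳) (y : Fin n → 𝒴) (i : Fin n) :
    0 < reverseChannel (jointCount x y) (x i) (y i) := by
  refine div_pos (jointCount_pos x y i) (Finset.sum_pos' (fun _ _ => by positivity)
    ⟨x i, Finset.mem_univ _, jointCount_pos x y i⟩)

variable [Fintype 𝒴]

lemma sum_eq_sum_jointCount (x : Fin n → 𝒳) (y : Fin n → 𝒴) (f : 𝒳 → 𝒴 → ℝ) :
    ∑ i, f (x i) (y i) = ∑ a, ∑ b, ((jointCount x y a b : ℕ) : ℝ) * f a b := by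
  rw [← Finset.sum_product', ← Finset.sum_fiberwise_of_maps_to (t := univ ×ˢ univ)
    (g := fun i => (x i, y i)) (by simp)]
  refine Finset.sum_congr rfl fun p _ => ?_
  rw [Finset.sum_congr rfl (g := fun _ => f p.1 p.2)]
  · simp [jointCount, Prod.ext_iff]
  · intro i hi
    simp only [Finset.mem_filter, Finset.mem_univ, true_and] at hi
    rw [← hi]

lemma mul_empMI_le_sum_log_score (hn : 0 < n) {Q : 𝒳 → ℝ} (hQ0 : ∀ a, 0 ≤ Q a)
    (hQ1 : ∑ a, Q a = 1) (x : Fin n → 𝒳) (y : Fin n → 𝒴) (hx : ∀ i, 0 < Q (x i)) :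
    n * empMI x y ≤ ∑ i, Real.logb 2 (score Q (jointCount x y) (x i) (y i)) := by
  have hn' : (0 : ℝ) < n := by exact_mod_cast hn
  have hp : ∀ a b, empDistOn univ x y a b = ((jointCount x y a b : ℕ) : ℝ) / n := by
    intro a b; simp [empDistOn, jointCount]
  set r : 𝒳 → ℝ := fun a => ∑ b, ((jointCount x y a b : ℕ) : ℝ) with hr
  set t : 𝒴 → ℝ := fun b => ∑ a, ((jointCount x y a b : ℕ) : ℝ) with ht
  have hrpos : ∀ i, 0 < r (x i) := fun i => Finset.sum_pos' (fun _ _ => by positivity)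
    ⟨y i, Finset.mem_univ _, jointCount_pos x y i⟩
  have htpos : ∀ i, 0 < t (y i) := fun i => Finset.sum_pos' (fun _ _ => by positivity)
    ⟨x i, Finset.mem_univ _, jointCount_pos x y i⟩
  have hMI : n * empMI x y = ∑ i, Real.logb 2
      (((jointCount x y (x i) (y i) : ℕ) : ℝ) / n / (r (x i) / n * (t (y i) / n))) := by
    rw [sum_eq_sum_jointCount x y (fun a b => Real.logb 2
      (((jointCount x y a b : ℕ) : ℝ) / n / (r a / n * (t b / n))))]
    simp only [empMI, miOf, hp, ← Finset.sum_div, Finset.mul_sum, hr, ht]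
    refine Finset.sum_congr rfl fun a _ => Finset.sum_congr rfl fun b _ => ?_
    rw [← mul_assoc, mul_div_cancel₀ _ hn'.ne']
  have hlog2 : 0 < Real.log 2 := Real.log_pos (by norm_num)
  have hQsum : ∑ i, n * Q (x i) / r (x i) ≤ n := by
    rw [sum_eq_sum_jointCount x y (fun a _ => n * Q a / r a)]
    simp only [← Finset.sum_mul]
    calc _ ≤ ∑ a, n * Q a := Finset.sum_le_sum fun a _ => by
            change r a * _ ≤ _
            have h1 : 0 ≤ n * Q a := mul_nonneg hn'.le (hQ0 a)
            rcases eq_or_ne (r a) 0 with h | h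
            · simpa [h] using h1
            · rw [mul_div_cancel₀ _ h]
      _ = n := by rw [← Finset.mul_sum, hQ1, mul_one]
  have hpt : ∀ i, Real.logb 2
      (((jointCount x y (x i) (y i) : ℕ) : ℝ) / n / (r (x i) / n * (t (y i) / n))) ≤
      Real.logb 2 (score Q (jointCount x y) (x i) (y i)) +
        (n * Q (x i) / r (x i) - 1) / Real.log 2 := by
    intro i
    have hj := jointCount_pos x y i
    have hq : 0 < n * Q (x i) / r (x i) := div_pos (mul_pos hn' (hx i)) (hrpos i)
    have hs : 0 < score Q (jointCount x y) (x i) (y i) :=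
      div_pos (reverseChannel_jointCount_pos x y i) (hx i)
    have heq : ((jointCount x y (x i) (y i) : ℕ) : ℝ) / n / (r (x i) / n * (t (y i) / n)) =
        score Q (jointCount x y) (x i) (y i) * (n * Q (x i) / r (x i)) := by
      have h1 := (hrpos i).ne'
      have h2 := (htpos i).ne'
      have h3 := (hx i).ne'
      have h4 : score Q (jointCount x y) (x i) (y i) =
        ((jointCount x y (x i) (y i) : ℕ) : ℝ) / t (y i) / Q (x i) := rfl
      rw [h4]
      field_simp
    rw [heq, Real.logb_mul hs.ne' hq.ne']
    gcongr
    exact div_le_div_of_nonneg_right (Real.log_le_sub_one_of_pos hq) hlog2.le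
  rw [hMI]
  refine (Finset.sum_le_sum fun i _ => hpt i).trans ?_
  rw [Finset.sum_add_distrib, ← Finset.sum_div, Finset.sum_sub_distrib]
  have : (∑ i, n * Q (x i) / r (x i) - ∑ _i : Fin n, (1 : ℝ)) / Real.log 2 ≤ 0 :=
    div_nonpos_of_nonpos_of_nonneg (by simpa using hQsum) hlog2.le
  linarith

end EmpiricalCounts

/-- Multiplicative overhead of the decoding threshold over the number of codewords. -/
noncomputable def thresholdOverhead (M n : ℕ) (Pe : ℝ) : ℝ := (n + 1 : ℝ) ^ M * (1 + 1 / Pe)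

lemma exists_chunk_length (M : ℕ) {Pe δ : ℝ} (hPe : 0 < Pe) (hδ : 0 < δ) (c : ℝ) :
    ∃ K : ℕ, 0 < K ∧
      c * (Real.logb 2 (thresholdOverhead M (K * K) Pe) + c) / K +
        (K + Real.logb 2 (thresholdOverhead M (K * K) Pe)) / (K * K) ≤ δ := by
  open Filter Topology in
  have hinv : Tendsto (fun K : ℕ => (1 : ℝ) / K) atTop (𝓝 0) :=
    tendsto_one_div_atTop_nhds_zero_nat
  open Filter Topology in
  have hlog : Tendsto (fun K : ℕ => Real.logb 2 (thresholdOverhead M (K * K) Pe) / K) atTop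
      (𝓝 0) := by
    have hA : ∀ K : ℕ, 0 < K → 0 ≤ Real.logb 2 (thresholdOverhead M (K * K) Pe) / K ∧
        Real.logb 2 (thresholdOverhead M (K * K) Pe) / K ≤
        (M * (1 + 2 * (Real.log K / Real.log 2)) + Real.logb 2 (1 + 1 / Pe)) / K := by
      intro K hK
      have hK' : (1 : ℝ) ≤ K := by exact_mod_cast hK
      have hK1 : (1 : ℝ) ≤ (K * K : ℝ) + 1 := by nlinarith
      have hP : 1 ≤ 1 + 1 / Pe := by have := one_div_pos.2 hPe; linarith
      refine ⟨div_nonneg (Real.logb_nonneg (by norm_num) ?_) (by positivity), ?_⟩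
      · unfold thresholdOverhead
        push_cast
        exact one_le_mul_of_one_le_of_one_le (one_le_pow₀ hK1) hP
      · gcongr
        unfold thresholdOverhead
        push_cast
        rw [Real.logb_mul (by positivity) (by positivity), Real.logb_pow]
        gcongr
        calc Real.logb 2 ((K : ℝ) * K + 1) ≤ Real.logb 2 (2 * (K : ℝ) ^ 2) :=
              Real.logb_le_logb_of_le (by norm_num) (by positivity) (by nlinarith)
          _ = _ := by
              rw [Real.logb_mul (by norm_num) (by positivity), Real.logb_pow,
                Real.logb_self_eq_one (by norm_num)]
              simp [Real.logb]
    have hlogK : Tendsto (fun K : ℕ => Real.log K / K) atTop (𝓝 0) :=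
      (Real.isLittleO_log_id_atTop.tendsto_div_nhds_zero).comp tendsto_natCast_atTop_atTop
    have hup : Tendsto (fun K : ℕ => (M * (1 + 2 * (Real.log K / Real.log 2)) +
        Real.logb 2 (1 + 1 / Pe)) / (K : ℝ)) atTop (𝓝 0) := by
      have := (hinv.const_mul (M + Real.logb 2 (1 + 1 / Pe))).add
        (hlogK.const_mul (M * 2 / Real.log 2))
      simp only [mul_zero, add_zero] at this
      refine this.congr fun K => ?_
      ring
    refine tendsto_of_tendsto_of_tendsto_of_le_of_le' tendsto_const_nhds hup ?_ ?_
    · filter_upwards [eventually_gt_atTop 0] with K hK using (hA K hK).1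
    · filter_upwards [eventually_gt_atTop 0] with K hK using (hA K hK).2
  have htot := ((hlog.const_mul c).add (hinv.const_mul (c * c))).add (hinv.add (hinv.mul hlog))
  simp only [mul_zero, add_zero] at htot
  obtain ⟨K, hK, hK0⟩ := ((htot.eventually_le_const hδ).and (Filter.eventually_gt_atTop 0)).exists
  refine ⟨K, hK0, le_trans (le_of_eq ?_) hK⟩
  have : (K : ℝ) ≠ 0 := by positivity
  field_simp

lemma rate_bound {n K B c T I δ : ℝ} (hn : 0 < n) (hK : 0 < K) (hKT : K ≤ T) (hc : 0 ≤ c)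
    (hI : I ≤ c) (hδ : 0 ≤ δ) (hB : n * I ≤ B * (T + c) + T)
    (hgap : c * (T - K + c) / K + T / n ≤ δ) : I - δ ≤ B * K / n := by
  by_contra! hlt
  have hBn : B ≤ c * n / K := by
    rw [le_div_iff₀ hK]
    have := (div_lt_iff₀ hn).1 hlt
    nlinarith
  have h1 : B * (T - K + c) ≤ c * n / K * (T - K + c) :=
    mul_le_mul_of_nonneg_right hBn (by linarith)
  have h2 : I ≤ B * K / n + (c * (T - K + c) / K + T / n) := by
    have h3 : B * K / n + (c * (T - K + c) / K + T / n) =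
      (B * K + c * n / K * (T - K + c) + T) / n := by field_simp; ring
    rw [h3, le_div_iff₀ hn]
    linarith
  linarith

/-- A finite probability law `W` transported along an equivalence. -/
lemma exists_measure_of_weights {Ω S : Type*} [Fintype Ω] [Fintype S] (e : Ω ≃ S) (W : Ω → ℝ)
    (hW0 : ∀ C, 0 ≤ W C) (hW1 : ∑ C, W C = 1) [MeasurableSpace S] [MeasurableSingletonClass S] :
    ∃ μ : Measure S, IsProbabilityMeasure μ ∧ ∀ (P : Ω → Prop) [DecidablePred P],
      μ {s | P (e.symm s)} = ENNReal.ofReal (∑ C, W C * if P C then 1 else 0) := by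
  classical
  let p : PMF S := PMF.ofFintype (fun s => ENNReal.ofReal (W (e.symm s))) (by
    rw [← ENNReal.ofReal_sum_of_nonneg (fun s _ => hW0 _), e.symm.sum_comp W, hW1,
      ENNReal.ofReal_one])
  refine ⟨p.toMeasure, inferInstance, fun P _ => ?_⟩
  rw [PMF.toMeasure_apply_fintype, ENNReal.ofReal_sum_of_nonneg (fun C _ => by
    have := hW0 C; split_ifs <;> simp [this]), ← e.symm.sum_comp]
  refine Finset.sum_congr rfl fun s _ => ?_
  by_cases h : P (e.symm s) <;> simp [h, p]

/-- Rate-adaptive achievability for discrete individual channels, with feedback.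
The scheme consists of: common randomness `S ∼ μ`; a feedback alphabet `F`; causal encoder
maps `enc k w s f` (reading only feedback before time `k`); decoder feedback functions
`fb k y s` (reading only outputs up to time `k`); a decoded message `dec y s ∈ {0,1}^∞`; and
a rate `rate y s ≥ 0` (in bits).  `inp w y s` is the resulting channel input sequence.
Conditions: (i) the input is i.i.d. `∼ Q` regardless of message and output (feedback);
(ii) for all `w, x, y` the conditional probability (given `input = x`) that the first
`⌈n·R⌉` decoded bits differ from `w` is `< Pe`; (iii) whenever the realized input lies
outside `J`, the decoded rate is at least `Î(x;y) - δ`; (iv) `Q^n(J) ≤ PA`. -/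
theorem statement13 {𝒳 𝒴 : Type*} [Fintype 𝒳] [Fintype 𝒴] [DecidableEq 𝒳] [DecidableEq 𝒴]
    (Pe PA δ : ℝ) (hPe : 0 < Pe) (hPA : 0 < PA) (hδ : 0 < δ)
    (Q : 𝒳 → ℝ) (hQ0 : ∀ a, 0 ≤ Q a) (hQ1 : ∑ a, Q a = 1) :
    ∃ n : ℕ, 0 < n ∧
    ∃ (S F : Type) (_ : MeasurableSpace S) (μ : Measure S), IsProbabilityMeasure μ ∧
    ∃ (enc : Fin n → (ℕ → Bool) → S → (Fin n → F) → 𝒳)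
      (fb : Fin n → (Fin n → 𝒴) → S → F)
      (dec : (Fin n → 𝒴) → S → (ℕ → Bool))
      (rate : (Fin n → 𝒴) → S → ℝ)
      (inp : (ℕ → Bool) → (Fin n → 𝒴) → S → (Fin n → 𝒳))
      (J : Set (Fin n → 𝒳)),
      -- the encoder at time k sees only feedback from times before k
      (∀ (k : Fin n) w s f f', (∀ j, j < k → f j = f' j) → enc k w s f = enc k w s f') ∧
      -- the feedback at time k depends only on the outputs up to time k
      (∀ (k : Fin n) y y' s, (∀ j, j ≤ k → y j = y' j) → fb k y s = fb k y' s) ∧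
      -- the rate is nonnegative
      (∀ y s, 0 ≤ rate y s) ∧
      -- the realized channel input sequence
      (∀ w y s k, inp w y s k = enc k w s (fun j => fb j y s)) ∧
      -- (i) input distributed Q^n, independently of the message and the feedback
      (∀ (w : ℕ → Bool) (y : Fin n → 𝒴) (x : Fin n → 𝒳),
        μ {s | inp w y s = x} = ENNReal.ofReal (∏ i, Q (x i))) ∧
      -- (ii) error probability smaller than Pe for every message, input and output
      (∀ (w : ℕ → Bool) (x : Fin n → 𝒳) (y : Fin n → 𝒴),
        μ ({s | ∃ j < Nat.ceil ((n : ℝ) * rate y s), dec y s j ≠ w j} ∩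
            {s | inp w y s = x}) / μ {s | inp w y s = x} < ENNReal.ofReal Pe) ∧
      -- (iii) rate at least the empirical mutual information minus δ, off J
      (∀ (w : ℕ → Bool) (y : Fin n → 𝒴) (s : S),
        inp w y s ∉ J → empMI (inp w y s) y - δ ≤ rate y s) ∧
      -- (iv) the exceptional input set has probability at most PA
      prodProb Q J ≤ PA := by
  classical
  obtain ⟨K, hK, hgap⟩ := exists_chunk_length (Fintype.card 𝒴 * Fintype.card 𝒳 + 2) hPe hδ
    (∑ a, |Real.logb 2 (Q a)|)
  set M := Fintype.card 𝒴 * Fintype.card 𝒳 + 2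
  set c := ∑ a, |Real.logb 2 (Q a)|
  have hc : 0 ≤ c := Finset.sum_nonneg fun _ _ => abs_nonneg _
  obtain ⟨n, hnK⟩ : ∃ n, n = K * K := ⟨_, rfl⟩
  have hn : 0 < n := hnK ▸ Nat.mul_pos hK hK
  have hn' : (0 : ℝ) < n := by exact_mod_cast hn
  have hK' : (0 : ℝ) < K := by exact_mod_cast hK
  rw [← hnK, show (K * K : ℝ) = n by rw [hnK]; push_cast; rfl] at hgap
  have hP : 1 < 1 + 1 / Pe := by have := one_div_pos.2 hPe; linarith
  have hover : 1 ≤ thresholdOverhead M n Pe :=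
    one_le_mul_of_one_le_of_one_le (one_le_pow₀ (by linarith)) hP.le
  set θ : ℝ := 2 ^ K * thresholdOverhead M n Pe with hθdef
  have hθ : 1 ≤ θ := one_le_mul_of_one_le_of_one_le (one_le_pow₀ (by norm_num)) hover
  have hlogθ : Real.logb 2 θ = K + Real.logb 2 (thresholdOverhead M n Pe) := by
    rw [hθdef, Real.logb_mul (by positivity) (by linarith), Real.logb_pow,
      Real.logb_self_eq_one (by norm_num), mul_one]
  have hover' := Real.logb_nonneg (b := 2) (by norm_num) hover
  let G := Fin K → Bool
  let g₀ : G := fun _ => false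
  let chunk : (ℕ → Bool) → ℕ → G := fun w b i => w (b * K + i)
  let Ω := G → Fin n → 𝒳
  let e : Ω ≃ Fin (Fintype.card Ω) := Fintype.equivFin Ω
  obtain ⟨μ, hμ, hprob⟩ := exists_measure_of_weights e (codebookWeight Q)
    (codebookWeight_nonneg hQ0) (by
      have := sum_prod_eq_one (ι := G) (sum_prod_eq_one (ι := Fin n) hQ1)
      exact this)
  let cnt : (Fin n → 𝒴) → Ω → ℕ → ℕ := fun y C k => (decState Q θ g₀ C y k).2.1
  have hinp : ∀ w y C, relabel Q θ g₀ (chunk w) y C g₀ =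
      fun k : Fin n => C (chunk w (cnt y C k)) k := by
    intro w y C
    funext k
    simp only [relabel, Equiv.swap_apply_left, cnt]
  have hlaw : ∀ (w : ℕ → Bool) (y : Fin n → 𝒴) (x : Fin n → 𝒳),
      μ {s | relabel Q θ g₀ (chunk w) y (e.symm s) g₀ = x} = ENNReal.ofReal (∏ i, Q (x i)) := by
    intro w y x
    rw [hprob (fun C => relabel Q θ g₀ (chunk w) y C g₀ = x),
      sum_codebookWeight_relabel Q θ g₀ (chunk w) y (fun C => if C g₀ = x then 1 else 0),
      sum_codebookWeight_fixed_row hQ1]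
  have hceil : ∀ y C, ⌈(n : ℝ) * ((cnt y C n : ℝ) * K / n)⌉₊ = cnt y C n * K := by
    intro y C
    rw [mul_div_cancel₀ _ hn'.ne', ← Nat.cast_mul, Nat.ceil_natCast]
  refine ⟨n, hn, Fin (Fintype.card Ω), ℕ, inferInstance, μ, hμ,
    fun k w s f => e.symm s (chunk w (if h : k.1 = 0 then 0 else f ⟨k.1 - 1, by omega⟩)) k,
    fun j y s => cnt y (e.symm s) (j + 1),
    fun y s j => (decState Q θ g₀ (e.symm s) y n).2.2 (j / K) ⟨j % K, Nat.mod_lt _ hK⟩,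
    fun y s => cnt y (e.symm s) n * K / n,
    fun w y s => relabel Q θ g₀ (chunk w) y (e.symm s) g₀,
    {x | ∃ i, Q (x i) = 0}, ?_, ?_, fun y s => by positivity, ?_, ?_, ?_, ?_, ?_⟩
  · intro k w s f f' hf
    by_cases h : k.1 = 0
    · simp only [h, dif_pos]
    · simp only [h, dif_neg, not_false_eq_true]
      rw [hf _ (Fin.lt_def.2 (by simp only; omega))]
  · intro k y y' s hy
    simp only [cnt]
    rw [decState_congr Q θ g₀ (k.1 + 1) (fun _ _ _ => rfl)
      (fun i hi => hy i (Fin.le_def.2 (by omega)))]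
  · intro w y s k
    simp only [hinp]
    by_cases h : k.1 = 0
    · simp [h, cnt, decState]
    · simp only [h, dif_neg, not_false_eq_true, Nat.sub_add_cancel (Nat.pos_of_ne_zero h)]
  · exact hlaw
  · intro w x y
    rw [hlaw]
    refine lt_of_le_of_lt (ENNReal.div_le_div_right (b := ENNReal.ofReal
      ((∏ i, Q (x i)) / (1 + 1 / Pe))) ?_ _) ?_
    · refine le_trans (measure_mono (t := {s | relabel Q θ g₀ (chunk w) y (e.symm s) g₀ = x ∧
        Confusable Q θ g₀ (relabel Q θ g₀ (chunk w) y (e.symm s)) y}) ?_) ?_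
      · rintro s ⟨⟨j, hj, hne⟩, hx⟩
        refine ⟨hx, ?_⟩
        by_contra hconf
        rw [hceil] at hj
        refine hne ?_
        beta_reduce
        rw [decoded_eq_of_not_confusable Q θ g₀ (chunk w) y (e.symm s) hconf n le_rfl (j / K)
          ((Nat.div_lt_iff_lt_mul hK).2 hj)]
        simp only [chunk, Nat.div_add_mod']
      · rw [hprob (fun C => relabel Q θ g₀ (chunk w) y C g₀ = x ∧
          Confusable Q θ g₀ (relabel Q θ g₀ (chunk w) y C) y),
          sum_codebookWeight_relabel Q θ g₀ (chunk w) y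
            (fun C => if C g₀ = x ∧ Confusable Q θ g₀ C y then 1 else 0)]
        refine ENNReal.ofReal_le_ofReal
          ((sum_codebookWeight_confusable_le hQ0 hQ1 g₀ (by linarith) x y).trans (le_of_eq ?_))
        have hcard : (Fintype.card G : ℝ) = 2 ^ K := by simp [G]
        rw [hcard, hθdef, thresholdOverhead]
        field_simp
        exact mul_comm _ _
    · have hPx : 0 ≤ ∏ i, Q (x i) := Finset.prod_nonneg fun _ _ => hQ0 _
      rcases hPx.eq_or_lt with h | h
      · simpa [← h] using hPe
      · rw [← ENNReal.ofReal_div_of_pos h, ENNReal.ofReal_lt_ofReal_iff hPe]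
        have : (∏ i, Q (x i)) / (1 + 1 / Pe) / ∏ i, Q (x i) = Pe / (Pe + 1) := by field_simp
        rw [this, div_lt_iff₀ (by linarith)]
        nlinarith
  · intro w y s hJ
    set x := relabel Q θ g₀ (chunk w) y (e.symm s) g₀ with hx
    have hxpos : ∀ i, 0 < Q (x i) := fun i =>
      (hQ0 _).lt_of_ne fun h => hJ ⟨i, h.symm⟩
    have hrev := reverseChannel_jointCount_pos x y
    have hlog : ∀ i, Real.logb 2 (score Q (jointCount x y) (x i) (y i)) ≤ c := fun i =>
      log_score_le _ _ _ (hrev i) (hxpos i)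
    have hMI := mul_empMI_le_sum_log_score hn hQ0 hQ1 x y hxpos
    have hsum := sum_log_score_le Q θ g₀ hθ (chunk w) y (e.symm s) (jointCount x y) c
      (fun i => div_pos (hrev i) (hxpos i)) hlog
    have hIc : empMI x y ≤ c := by
      have : n * empMI x y ≤ n * c := hMI.trans
        ((Finset.sum_le_sum fun i _ => hlog i).trans_eq (by simp))
      exact le_of_mul_le_mul_left this hn'
    refine rate_bound hn' hK' (T := Real.logb 2 θ) (by linarith) hc hIc hδ.le
      (hMI.trans hsum) ?_
    rw [hlogθ, add_sub_cancel_left]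
    exact hgap
  · refine le_trans (le_of_eq (Finset.sum_eq_zero fun x _ => ?_)) hPA.le
    rw [Set.indicator_apply_eq_zero]
    rintro ⟨i, hi⟩
    exact Finset.prod_eq_zero (Finset.mem_univ i) hi
end
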